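/- arXiv:2010.07685 — 6 statements merged into one kernel-verified Lean document; each statement's English description precedes it below -/
import Mathlib

section
/- Let a, b, c be real numbers such that u := −ab + ac + bc, v := ab + ac − bc, and w := ab − ac + bc are all nonzero, and set ν₁ := abc/u, ν₂ := abc/v, ν₃ := abc/w (the roots of the cubic G₄(ν) = (uν − abc)(vν − abc)(wν − abc)). Then (uvw)⁴·(ν₁ − ν₂)²·(ν₁ − ν₃)²·(ν₂ − ν₃)² = 2⁶·(abc)⁸·(a − b)²·(a − c)²·(b − c)². -/
theorem discriminant_G4 (a b c u v w ν₁ ν₂ ν₃ : ℝ)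
    (hu : u = -(a * b) + a * c + b * c) (hv : v = a * b + a * c - b * c)
    (hw : w = a * b - a * c + b * c)
    (hu0 : u ≠ 0) (hv0 : v ≠ 0) (hw0 : w ≠ 0)
    (hν₁ : ν₁ = a * b * c / u) (hν₂ : ν₂ = a * b * c / v) (hν₃ : ν₃ = a * b * c / w) :
    (u * v * w) ^ 4 * (ν₁ - ν₂) ^ 2 * (ν₁ - ν₃) ^ 2 * (ν₂ - ν₃) ^ 2
      = 2 ^ 6 * (a * b * c) ^ 8 * (a - b) ^ 2 * (a - c) ^ 2 * (b - c) ^ 2 := by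
  have h₁₂ : u * v * (ν₁ - ν₂) = a * b * c * (v - u) := by
    rw [hν₁, hν₂]; field_simp
  have h₁₃ : u * w * (ν₁ - ν₃) = a * b * c * (w - u) := by
    rw [hν₁, hν₃]; field_simp
  have h₂₃ : v * w * (ν₂ - ν₃) = a * b * c * (w - v) := by
    rw [hν₂, hν₃]; field_simp
  calc (u * v * w) ^ 4 * (ν₁ - ν₂) ^ 2 * (ν₁ - ν₃) ^ 2 * (ν₂ - ν₃) ^ 2
      = (u * v * (ν₁ - ν₂)) ^ 2 * (u * w * (ν₁ - ν₃)) ^ 2 * (v * w * (ν₂ - ν₃)) ^ 2 := by ring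
    _ = (a * b * c * (v - u)) ^ 2 * (a * b * c * (w - u)) ^ 2 * (a * b * c * (w - v)) ^ 2 := by
      rw [h₁₂, h₁₃, h₂₃]
    _ = 2 ^ 6 * (a * b * c) ^ 8 * (a - b) ^ 2 * (a - c) ^ 2 * (b - c) ^ 2 := by
      have hvu : v - u = 2 * b * (a - c) := by rw [hu, hv]; ring
      have hwu : w - u = 2 * a * (b - c) := by rw [hu, hw]; ring
      have hwv : w - v = 2 * c * (b - a) := by rw [hv, hw]; ring
      rw [hvu, hwu, hwv]; ring
end

section
/- Let t₁, t₂, t₃, u be nonzero real numbers and σ ∈ {−1, 1} be such that σ·t₁t₂t₃/u > 0. Define f(x) := √(σ·(x − t₁)(x − t₂)(x − t₃)/(x − u)) on a neighborhood of 0 (where the radicand is positive). Then the second derivative of f at 0 vanishes if and only if (4e₁e₃ − e₂²)·u² − 2e₂e₃·u + 3e₃² = 0, where e₁ = t₁ + t₂ + t₃, e₂ = t₁t₂ + t₁t₃ + t₂t₃, e₃ = t₁t₂t₃. -/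
open Filter Topology in
/-- The second derivative of `√g` at a point where `g` is positive. -/
theorem iteratedDeriv_two_sqrt {g g' : ℝ → ℝ} {g'' a : ℝ}
    (hg : ∀ᶠ x in 𝓝 a, HasDerivAt g (g' x) x) (hg' : HasDerivAt g' g'' a) (ha : 0 < g a) :
    iteratedDeriv 2 (fun x => √(g x)) a =
      (2 * g a * g'' - g' a ^ 2) / (4 * (g a * √(g a))) := by
  have hga : HasDerivAt g (g' a) a := hg.self_of_nhds
  have hev : deriv (fun x => √(g x)) =ᶠ[𝓝 a] fun x => g' x / (2 * √(g x)) := by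
    filter_upwards [hg, hga.continuousAt.eventually (lt_mem_nhds ha)] with x hx hpos
    exact (hx.sqrt hpos.ne').deriv
  have hs : √(g a) ≠ 0 := (Real.sqrt_pos.2 ha).ne'
  have hsq : √(g a) ^ 2 = g a := Real.sq_sqrt ha.le
  rw [iteratedDeriv_succ, iteratedDeriv_one, hev.deriv_eq,
    (hg'.fun_div ((hga.sqrt ha.ne').const_mul 2) (by positivity)).deriv]
  generalize √(g a) = s at *
  rw [← hsq]
  field_simp
  ring

theorem second_deriv_sqrt_condition (t₁ t₂ t₃ u : ℝ)
    (ht₁ : t₁ ≠ 0) (ht₂ : t₂ ≠ 0) (ht₃ : t₃ ≠ 0) (hu : u ≠ 0)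
    (σ : ℝ) (hσ : σ = -1 ∨ σ = 1) (hpos : σ * (t₁ * t₂ * t₃) / u > 0)
    (f : ℝ → ℝ)
    (hf : f = fun x => Real.sqrt (σ * ((x - t₁) * (x - t₂) * (x - t₃)) / (x - u)))
    (e₁ e₂ e₃ : ℝ) (he₁ : e₁ = t₁ + t₂ + t₃)
    (he₂ : e₂ = t₁ * t₂ + t₁ * t₃ + t₂ * t₃) (he₃ : e₃ = t₁ * t₂ * t₃) :
    iteratedDeriv 2 f 0 = 0 ↔
      (4 * e₁ * e₃ - e₂ ^ 2) * u ^ 2 - 2 * e₂ * e₃ * u + 3 * e₃ ^ 2 = 0 := by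
  have hcubic (x : ℝ) : (x - t₁) * (x - t₂) * (x - t₃) = x ^ 3 - e₁ * x ^ 2 + e₂ * x - e₃ := by
    rw [he₁, he₂, he₃]; ring
  rw [← he₃] at hpos
  simp only [hcubic] at hf
  have hN (x : ℝ) : HasDerivAt (fun x => σ * (x ^ 3 - e₁ * x ^ 2 + e₂ * x - e₃))
      (σ * (3 * x ^ 2 - 2 * e₁ * x + e₂)) x :=
    ((((((hasDerivAt_pow 3 x).fun_sub ((hasDerivAt_pow 2 x).const_mul e₁)).fun_add
      ((hasDerivAt_id' x).const_mul e₂)).sub_const e₃).const_mul σ)).congr_deriv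
        (by norm_num; ring_nf; simp)
  have hN' (x : ℝ) : HasDerivAt (fun x => σ * (3 * x ^ 2 - 2 * e₁ * x + e₂))
      (σ * (6 * x - 2 * e₁)) x :=
    (((((hasDerivAt_pow 2 x).const_mul 3).fun_sub
      ((hasDerivAt_id' x).const_mul (2 * e₁))).add_const e₂).const_mul σ).congr_deriv
        (by norm_num; ring_nf; simp)
  have hD (x : ℝ) : HasDerivAt (fun x => x - u) 1 x := (hasDerivAt_id x).sub_const u
  have hu0 : (0 : ℝ) - u ≠ 0 := by simpa using hu
  have hg := ((hD 0).continuousAt.eventually_ne hu0).mono fun x hx => (hN x).fun_div (hD x) hx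
  have hg' := (((hN' 0).fun_mul (hD 0)).fun_sub ((hN 0).mul_const 1)).fun_div
    ((hD 0).fun_pow 2) (pow_ne_zero 2 hu0)
  have hg0 : σ * ((0 : ℝ) ^ 3 - e₁ * 0 ^ 2 + e₂ * 0 - e₃) / (0 - u) = σ * e₃ / u := by
    field_simp; ring
  have hσ2 : σ ^ 2 = 1 := by rcases hσ with rfl | rfl <;> norm_num
  rw [hf, iteratedDeriv_two_sqrt hg hg' (by rw [hg0]; exact hpos), hg0, div_eq_zero_iff,
    or_iff_left (by positivity)]
  have key (A B : ℝ) (h : A = σ ^ 2 * B / u ^ 4) : A = 0 ↔ B = 0 := by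
    rw [h, hσ2, one_mul, div_eq_zero_iff, or_iff_left (pow_ne_zero 4 hu)]
  apply key
  simp only [zero_sub]
  field_simp
  ring
end

section
/- Let α be a real number with α² ≠ 1 and let m ≥ 1. For every real x, setting w := (2x² − 1 − α²)/(1 − α²), the identity T_m(w)² − (x² − 1)(x² − α²)·(2·U_{m−1}(w)/(1 − α²))² = 1 holds, where T_m and U_{m−1} are the Chebyshev polynomials of the first and second kind. -/
open Polynomial Polynomial.Chebyshev

/-- The Pell equation for Chebyshev polynomials. -/
theorem chebyshev_pell (R : Type*) [CommRing R] (n : ℕ) :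
    T R n ^ 2 - (X ^ 2 - 1) * U R ((n : ℤ) - 1) ^ 2 = 1 := by
  induction n with
  | zero => simp
  | succ n ih =>
    have hT := T_eq_X_mul_T_sub_pol_U R ((n : ℤ) - 1)
    have hU := U_eq_X_mul_U_add_T R ((n : ℤ) - 1)
    rw [show (n : ℤ) - 1 + 2 = n + 1 by ring, sub_add_cancel] at hT
    rw [sub_add_cancel] at hU
    push_cast
    rw [add_sub_cancel_right, hT, hU]
    linear_combination ih

theorem akhiezer_pell (α : ℝ) (hα : α ^ 2 ≠ 1) (m : ℕ) (hm : 1 ≤ m) (x : ℝ) :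
    ((T ℝ m).eval ((2 * x ^ 2 - 1 - α ^ 2) / (1 - α ^ 2))) ^ 2
      - (x ^ 2 - 1) * (x ^ 2 - α ^ 2)
        * (2 * (U ℝ ((m : ℤ) - 1)).eval ((2 * x ^ 2 - 1 - α ^ 2) / (1 - α ^ 2))
            / (1 - α ^ 2)) ^ 2 = 1 := by
  have hα' : 1 - α ^ 2 ≠ 0 := sub_ne_zero.mpr hα.symm
  set w := (2 * x ^ 2 - 1 - α ^ 2) / (1 - α ^ 2) with hw
  have hpell := congrArg (eval w) (chebyshev_pell ℝ m)
  simp only [eval_sub, eval_mul, eval_pow, eval_X, eval_one] at hpell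
  have hw' : w ^ 2 - 1 = (x ^ 2 - 1) * (x ^ 2 - α ^ 2) * (2 / (1 - α ^ 2)) ^ 2 := by
    rw [hw]
    field_simp
    ring
  rw [hw'] at hpell
  linear_combination hpell
end

section
/- Let a, b be real numbers with 0 < a < b < 2a, set c := ab/(b − a), and define w(s) := (2ab²s² − 2b²s + b − a)/(b − a). Then for every real s, T₂(w(s))² − s(s − 1/a)(s − 1/b)(s − 1/c)·((2ab²/(b − a))·U₁(w(s)))² = 1, where T₂(x) = 2x² − 1 and U₁(x) = 2x are Chebyshev polynomials of the first and second kind. -/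
theorem lightlike_period4_collared (a b c : ℝ) (ha : 0 < a) (hab : a < b) (hb2a : b < 2 * a)
    (hc : c = a * b / (b - a)) (w : ℝ → ℝ)
    (hw : w = fun s => (2 * a * b ^ 2 * s ^ 2 - 2 * b ^ 2 * s + b - a) / (b - a))
    (T₂ U₁ : ℝ → ℝ) (hT₂ : T₂ = fun x => 2 * x ^ 2 - 1) (hU₁ : U₁ = fun x => 2 * x)
    (s : ℝ) :
    (T₂ (w s)) ^ 2
      - s * (s - 1 / a) * (s - 1 / b) * (s - 1 / c)
        * ((2 * a * b ^ 2 / (b - a)) * U₁ (w s)) ^ 2 = 1 := by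
  have ha0 : a ≠ 0 := ha.ne'
  have hb0 : b ≠ 0 := (ha.trans hab).ne'
  have hd : b - a ≠ 0 := (sub_pos.mpr hab).ne'
  subst hc hw hT₂ hU₁
  field_simp
  ring
end

section
/- Let a, c be real numbers with 0 < a < c, set b := ac/(a − c), and define w(s) := (2a²cs² − 2a²s − (c − a))/(c − a). Then for every real s, T₂(w(s))² − s(s − 1/a)(s − 1/b)(s − 1/c)·((2a²c/(c − a))·U₁(w(s)))² = 1, where T₂(x) = 2x² − 1 and U₁(x) = 2x are Chebyshev polynomials of the first and second kind. -/
theorem lightlike_period4_transverse (a c b : ℝ) (ha : 0 < a) (hac : a < c)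
    (hb : b = a * c / (a - c)) (w : ℝ → ℝ)
    (hw : w = fun s => (2 * a ^ 2 * c * s ^ 2 - 2 * a ^ 2 * s - (c - a)) / (c - a))
    (T₂ U₁ : ℝ → ℝ) (hT₂ : T₂ = fun x => 2 * x ^ 2 - 1) (hU₁ : U₁ = fun x => 2 * x)
    (s : ℝ) :
    (T₂ (w s)) ^ 2
      - s * (s - 1 / a) * (s - 1 / b) * (s - 1 / c)
        * ((2 * a ^ 2 * c / (c - a)) * U₁ (w s)) ^ 2 = 1 := by
  have hc : c ≠ 0 := (ha.trans hac).ne'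
  have ha' : a ≠ 0 := ha.ne'
  have hd : c - a ≠ 0 := sub_ne_zero.2 hac.ne'
  have hb' : 1 / b = 1 / c - 1 / a := by
    rw [hb, one_div_div]
    field_simp
  have h_add : w s + 1 = 2 * a ^ 2 * c / (c - a) * (s * (s - 1 / c)) := by
    rw [hw]
    field_simp
    ring
  have h_sub : w s - 1 = 2 * a ^ 2 * c / (c - a) * ((s - 1 / a) * (s - 1 / b)) := by
    rw [hw, hb']
    field_simp
    ring
  rw [hT₂, hU₁]
  linear_combination 4 * w s ^ 2 * (w s - 1) * h_add
    + 4 * w s ^ 2 * (2 * a ^ 2 * c / (c - a) * (s * (s - 1 / c))) * h_sub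
end

section
/- Let Y ∈ (0, 1) and κ ∈ ℝ, and let C > 0 and D > 0 be real numbers satisfying C² = 1 − Y², D² = 1 − κ²Y², and 1 − κ²Y⁴ ≠ 0. If C/D = 2Y·C·D/(1 − κ²Y⁴), then κ² = (2Y − 1)/(Y³(2 − Y)) and (C/D)² = Y(2 − Y). -/
theorem elliptic_modulus_three_periodic (Y κ C D : ℝ)
    (hY0 : 0 < Y) (hY1 : Y < 1) (hC : 0 < C) (hD : 0 < D)
    (hC2 : C ^ 2 = 1 - Y ^ 2) (hD2 : D ^ 2 = 1 - κ ^ 2 * Y ^ 2)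
    (hden : 1 - κ ^ 2 * Y ^ 4 ≠ 0)
    (heq : C / D = 2 * Y * C * D / (1 - κ ^ 2 * Y ^ 4)) :
    κ ^ 2 = (2 * Y - 1) / (Y ^ 3 * (2 - Y)) ∧ (C / D) ^ 2 = Y * (2 - Y) := by
  have hY2 : 0 < 2 - Y := by linarith
  have hmul : C * (1 - κ ^ 2 * Y ^ 4) = C * (2 * Y * D ^ 2) := by
    rw [div_eq_div_iff hD.ne' hden] at heq
    linear_combination heq
  have key : κ ^ 2 * (Y ^ 3 * (2 - Y)) = 2 * Y - 1 := by
    linear_combination mul_left_cancel₀ hC.ne' hmul + 2 * Y * hD2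
  refine ⟨(eq_div_iff (by positivity)).2 key, ?_⟩
  rw [div_pow, div_eq_iff (by positivity)]
  linear_combination hC2 - Y * (2 - Y) * hD2 + key
end
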